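/- arXiv:1605.08798 — 3 statements merged into one kernel-verified Lean document; each statement's English description precedes it below -/
import Mathlib

section
/- Let β > 1 be a real number, and let A, Â, B, B̂ be real symmetric d×d matrices with A and Â positive semidefinite and B and B̂ positive definite, satisfying the Loewner-order sandwiches ((β−1)/β)·A ⪯ Â ⪯ ((β+1)/β)·A and ((β−1)/β)·B ⪯ B̂ ⪯ ((β+1)/β)·B. Then tr[B⁻¹·A] ≤ ((β+1)/(β−1))·tr[B̂⁻¹·Â]. -/
open Matrix

open scoped MatrixOrder in
theorem Matrix.PosSemidef.trace_mul_nonneg {n : Type*} [Fintype n] [DecidableEq n]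
    {M N : Matrix n n ℝ} (hM : M.PosSemidef) (hN : N.PosSemidef) : 0 ≤ (M * N).trace := by
  obtain ⟨X, rfl⟩ := CStarAlgebra.nonneg_iff_eq_star_mul_self.mp hN.nonneg
  rw [← Matrix.mul_assoc, Matrix.trace_mul_comm, ← Matrix.mul_assoc]
  exact (hM.mul_mul_conjTranspose_same X).trace_nonneg

/-- Inversion reverses the Loewner order on positive definite matrices. -/
theorem Matrix.PosDef.posSemidef_inv_sub_inv {n : Type*} [Fintype n] [DecidableEq n]
    {M N : Matrix n n ℝ} (hM : M.PosDef) (hN : N.PosDef) (h : (N - M).PosSemidef) :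
    (M⁻¹ - N⁻¹).PosSemidef := by
  have : Invertible N := hN.isUnit.invertible
  have : Invertible M := hM.isUnit.invertible
  have h₁ := Matrix.PosDef.fromBlocks₁₁ (1 : Matrix n n ℝ) M⁻¹ hN
  have h₂ := Matrix.PosDef.fromBlocks₂₂ N (1 : Matrix n n ℝ) hM.inv
  simp only [conjTranspose_one, Matrix.mul_one, Matrix.one_mul, inv_inv_of_invertible] at h₁ h₂
  exact h₁.mp (h₂.mpr h)

/-- Matrix content of Remark 6: Loewner sandwiches
`((β-1)/β) A ⪯ Â ⪯ ((β+1)/β) A` and `((β-1)/β) B ⪯ B̂ ⪯ ((β+1)/β) B`, with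
`A, Â` positive semidefinite and `B, B̂` positive definite, imply
`tr[B⁻¹ A] ≤ ((β+1)/(β-1)) tr[B̂⁻¹ Â]`. -/
theorem stmt3 {d : ℕ} (β : ℝ) (hβ : 1 < β)
    (A Ahat B Bhat : Matrix (Fin d) (Fin d) ℝ)
    (hA : A.PosSemidef) (hAhat : Ahat.PosSemidef)
    (hB : B.PosDef) (hBhat : Bhat.PosDef)
    (hA₁ : (Ahat - ((β - 1) / β) • A).PosSemidef)
    (hA₂ : (((β + 1) / β) • A - Ahat).PosSemidef)
    (hB₁ : (Bhat - ((β - 1) / β) • B).PosSemidef)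
    (hB₂ : (((β + 1) / β) • B - Bhat).PosSemidef) :
    (B⁻¹ * A).trace ≤ ((β + 1) / (β - 1)) * (Bhat⁻¹ * Ahat).trace := by
  have hβ₀ : 0 < β := by linarith
  have hβ₁ : 0 < β - 1 := by linarith
  have hc : 0 < (β + 1) / β := by positivity
  have hinv := hBhat.posSemidef_inv_sub_inv (hB.smul hc) hB₂
  have h₁ := hinv.trace_mul_nonneg hA
  have h₂ := hBhat.inv.posSemidef.trace_mul_nonneg hA₁
  have hsmul : (((β + 1) / β) • B)⁻¹ = ((β + 1) / β)⁻¹ • B⁻¹ := by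
    have := invertibleOfNonzero hc.ne'
    rw [Matrix.inv_smul B _ ((Matrix.isUnit_iff_isUnit_det B).mp hB.isUnit), invOf_eq_inv]
  rw [hsmul, Matrix.sub_mul, Matrix.trace_sub, Matrix.smul_mul, Matrix.trace_smul, smul_eq_mul,
    sub_nonneg, inv_mul_le_iff₀ hc] at h₁
  rw [Matrix.mul_sub, Matrix.trace_sub, Matrix.mul_smul, Matrix.trace_smul, smul_eq_mul,
    sub_nonneg] at h₂
  calc (B⁻¹ * A).trace ≤ (β + 1) / β * (Bhat⁻¹ * A).trace := h₁
    _ = (β + 1) / (β - 1) * ((β - 1) / β * (Bhat⁻¹ * A).trace) := by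
      field_simp
    _ ≤ (β + 1) / (β - 1) * (Bhat⁻¹ * Ahat).trace := by gcongr
end

section
/- Let X_p be a nonempty finite set, c ≥ 1 an integer, a : X_p × {1,…,c} → ℝ a strictly positive function, and g : X_p × {1,…,c} × X_p → ℝ a nonnegative function. Define the set function f on subsets of X_p by f(S) := Σ_{x ∈ X_p \ S} Σ_{y=1}^c (−1)/(a(x,y) + Σ_{x' ∈ S} g(x,y,x')). Then f is monotone nondecreasing (S ⊆ T implies f(S) ≤ f(T)) and submodular (f(S ∪ {ξ}) − f(S) ≥ f(T ∪ {ξ}) − f(T) whenever S ⊆ T ⊆ X_p and ξ ∈ X_p \ T). -/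
open Finset

/-- The simplified FIR set objective
`f(S) = Σ_{x ∈ X_p \ S} Σ_y (-1) / (a(x,y) + Σ_{x' ∈ S} g(x,y,x'))`,
where the ground set `X_p` is the whole (finite) type `α`. -/
noncomputable def firObjective {α : Type*} [Fintype α] [DecidableEq α] (c : ℕ)
    (a : α → Fin c → ℝ) (g : α → Fin c → α → ℝ) (S : Finset α) : ℝ :=
  ∑ x ∈ Sᶜ, ∑ y : Fin c, (-1) / (a x y + ∑ x' ∈ S, g x y x')

theorem inv_sub_inv_add_anti {u v t : ℝ} (hu : 0 < u) (huv : u ≤ v) (ht : 0 ≤ t) :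
    v⁻¹ - (v + t)⁻¹ ≤ u⁻¹ - (u + t)⁻¹ := by
  have hdiff : ∀ w : ℝ, 0 < w → w⁻¹ - (w + t)⁻¹ = t / (w * (w + t)) := fun w hw => by
    have : w + t ≠ 0 := by positivity
    field_simp
    ring
  have hv : 0 < v := hu.trans_le huv
  rw [hdiff v hv, hdiff u hu]
  gcongr

/-- The marginal gain of adding `ξ ∉ S`, written so that each term is antitone in `S`. -/
theorem firObjective_insert_sub {α : Type*} [Fintype α] [DecidableEq α] {c : ℕ}
    (a : α → Fin c → ℝ) (g : α → Fin c → α → ℝ) {S : Finset α} {ξ : α} (hξ : ξ ∉ S) :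
    firObjective c a g (insert ξ S) - firObjective c a g S =
      (∑ x ∈ (insert ξ S)ᶜ, ∑ y, ((a x y + ∑ x' ∈ S, g x y x')⁻¹ -
        (a x y + ∑ x' ∈ S, g x y x' + g x y ξ)⁻¹)) +
        ∑ y, (a ξ y + ∑ x' ∈ S, g ξ y x')⁻¹ := by
  have hS : Sᶜ = insert ξ (insert ξ S)ᶜ := by
    rw [compl_insert, insert_erase (mem_compl.2 hξ)]
  have hmem : ξ ∉ (insert ξ S)ᶜ := by simp
  have hsum : ∀ x y, a x y + ∑ x' ∈ insert ξ S, g x y x' =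
      a x y + ∑ x' ∈ S, g x y x' + g x y ξ := fun x y => by
    rw [sum_insert hξ]
    ring
  unfold firObjective
  rw [hS, sum_insert hmem]
  simp only [hsum, neg_div, one_div, sum_neg_distrib, sum_sub_distrib]
  ring

theorem add_sum_pos_of_nonneg {α : Type*} {r : ℝ} {w : α → ℝ} (hr : 0 < r)
    (hw : ∀ x, 0 ≤ w x) (S : Finset α) : 0 < r + ∑ x ∈ S, w x :=
  add_pos_of_pos_of_nonneg hr (sum_nonneg fun x _ => hw x)

theorem firObjective_mono {α : Type*} [Fintype α] [DecidableEq α] {c : ℕ}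
    {a : α → Fin c → ℝ} (ha : ∀ x y, 0 < a x y)
    {g : α → Fin c → α → ℝ} (hg : ∀ x y x', 0 ≤ g x y x') {S T : Finset α} (hST : S ⊆ T) :
    firObjective c a g S ≤ firObjective c a g T := by
  have hpos : ∀ x y, 0 < a x y + ∑ x' ∈ S, g x y x' := fun x y =>
    add_sum_pos_of_nonneg (ha x y) (hg x y) S
  simp only [firObjective, neg_div, one_div, sum_neg_distrib, neg_le_neg_iff]
  calc ∑ x ∈ Tᶜ, ∑ y, (a x y + ∑ x' ∈ T, g x y x')⁻¹
      ≤ ∑ x ∈ Tᶜ, ∑ y, (a x y + ∑ x' ∈ S, g x y x')⁻¹ :=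
        sum_le_sum fun x _ => sum_le_sum fun y _ =>
          inv_anti₀ (hpos x y) (add_le_add_right
            (sum_le_sum_of_subset_of_nonneg hST fun x' _ _ => hg x y x') _)
    _ ≤ ∑ x ∈ Sᶜ, ∑ y, (a x y + ∑ x' ∈ S, g x y x')⁻¹ :=
        sum_le_sum_of_subset_of_nonneg (compl_subset_compl.2 hST) fun x _ _ =>
          sum_nonneg fun y _ => (inv_pos.2 (hpos x y)).le

theorem firObjective_submodular {α : Type*} [Fintype α] [DecidableEq α] {c : ℕ}
    {a : α → Fin c → ℝ} (ha : ∀ x y, 0 < a x y)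
    {g : α → Fin c → α → ℝ} (hg : ∀ x y x', 0 ≤ g x y x') {S T : Finset α} (hST : S ⊆ T)
    {ξ : α} (hξ : ξ ∉ T) :
    firObjective c a g (insert ξ T) - firObjective c a g T ≤
      firObjective c a g (insert ξ S) - firObjective c a g S := by
  have hpos : ∀ x y, 0 < a x y + ∑ x' ∈ S, g x y x' := fun x y =>
    add_sum_pos_of_nonneg (ha x y) (hg x y) S
  have hle : ∀ x y, a x y + ∑ x' ∈ S, g x y x' ≤ a x y + ∑ x' ∈ T, g x y x' := fun x y =>
    add_le_add_right (sum_le_sum_of_subset_of_nonneg hST fun x' _ _ => hg x y x') _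
  rw [firObjective_insert_sub a g hξ, firObjective_insert_sub a g fun h => hξ (hST h)]
  refine add_le_add ?_ (sum_le_sum fun y _ => inv_anti₀ (hpos ξ y) (hle ξ y))
  refine (sum_le_sum fun x _ => sum_le_sum fun y _ =>
    inv_sub_inv_add_anti (hpos x y) (hle x y) (hg x y ξ)).trans ?_
  refine sum_le_sum_of_subset_of_nonneg (compl_subset_compl.2 (insert_subset_insert ξ hST))
    fun x _ _ => sum_nonneg fun y _ => sub_nonneg.2 (inv_anti₀ (hpos x y) ?_)
  exact le_add_of_nonneg_right (hg x y ξ)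

/-- The simplified FIR objective is monotone nondecreasing and submodular for any
strictly positive `a` and nonnegative `g`. -/
theorem stmt4 {α : Type*} [Fintype α] [DecidableEq α] [Nonempty α]
    {c : ℕ} (hc : 1 ≤ c)
    (a : α → Fin c → ℝ) (ha : ∀ x y, 0 < a x y)
    (g : α → Fin c → α → ℝ) (hg : ∀ x y x', 0 ≤ g x y x') :
    (∀ S T : Finset α, S ⊆ T → firObjective c a g S ≤ firObjective c a g T) ∧
      (∀ S T : Finset α, S ⊆ T → ∀ ξ, ξ ∉ T →
        firObjective c a g (insert ξ T) - firObjective c a g T ≤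
          firObjective c a g (insert ξ S) - firObjective c a g S) := by
  exact ⟨fun _ _ hST => firObjective_mono ha hg hST,
    fun _ _ hST _ hξ => firObjective_submodular ha hg hST hξ⟩
end

section
/- Let X_q ⊆ X_p be nonempty finite sets, c ≥ 1 an integer, δ > 0, and v : X_p × {1,…,c} → ℝ^d. Define the Monte-Carlo Fisher approximation Î(S) := (1/|S|)·Σ_{x∈S} Σ_{y=1}^c v(x,y)·v(x,y)ᵀ + δ·I_d for a nonempty finite set S, which is symmetric positive definite. Then tr[Î(X_q)⁻¹·Î(X_p)] = (|X_q|·d)/|X_p| + (1/|X_p|)·Σ_{x ∈ X_p \ X_q} Σ_{y=1}^c v(x,y)ᵀ·Î(X_q)⁻¹·v(x,y) + δ·((|X_p|−|X_q|)/|X_p|)·tr[Î(X_q)⁻¹]. -/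
open Finset Matrix

/-- Monte-Carlo approximation of a Fisher information matrix over a finite sample set
`S`: `Î(S) = (1/|S|) Σ_{x ∈ S} Σ_y v(x,y) v(x,y)ᵀ + δ I_d`. -/
noncomputable def mcFisher {α : Type*} (d c : ℕ) (δ : ℝ)
    (v : α → Fin c → (Fin d → ℝ)) (S : Finset α) : Matrix (Fin d) (Fin d) ℝ :=
  ((S.card : ℝ)⁻¹) • (∑ x ∈ S, ∑ y : Fin c, Matrix.vecMulVec (v x y) (v x y)) +
    δ • (1 : Matrix (Fin d) (Fin d) ℝ)

lemma mcFisher_posDef {α : Type*} {d c : ℕ} {δ : ℝ} (hδ : 0 < δ)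
    (v : α → Fin c → (Fin d → ℝ)) (S : Finset α) : (mcFisher d c δ v S).PosDef := by
  refine Matrix.PosDef.posSemidef_add (Matrix.PosSemidef.smul ?_ (by positivity))
    (Matrix.PosDef.one.smul hδ)
  refine Matrix.posSemidef_sum _ fun x _ => Matrix.posSemidef_sum _ fun y _ => ?_
  simpa using Matrix.posSemidef_vecMulVec_self_star (v x y)

lemma card_smul_mcFisher {α : Type*} {d c : ℕ} (δ : ℝ)
    (v : α → Fin c → (Fin d → ℝ)) {S : Finset α} (hS : S.Nonempty) :
    (S.card : ℝ) • mcFisher d c δ v S =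
      ∑ x ∈ S, ∑ y : Fin c, Matrix.vecMulVec (v x y) (v x y) +
        (S.card * δ) • (1 : Matrix (Fin d) (Fin d) ℝ) := by
  have h : (S.card : ℝ) ≠ 0 := by exact_mod_cast hS.card_pos.ne'
  rw [mcFisher, smul_add, smul_inv_smul₀ h, smul_smul]

/-- Enlarging the sample set adds the rank-one terms of the new points and a multiple of the
identity to the unnormalized Fisher approximation. -/
lemma card_smul_mcFisher_of_subset {α : Type*} [DecidableEq α] {d c : ℕ} (δ : ℝ)
    (v : α → Fin c → (Fin d → ℝ)) {S T : Finset α} (hST : S ⊆ T) (hS : S.Nonempty) :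
    (T.card : ℝ) • mcFisher d c δ v T =
      (S.card : ℝ) • mcFisher d c δ v S +
        ∑ x ∈ T \ S, ∑ y : Fin c, Matrix.vecMulVec (v x y) (v x y) +
        (((T.card : ℝ) - S.card) * δ) • (1 : Matrix (Fin d) (Fin d) ℝ) := by
  rw [card_smul_mcFisher δ v (hS.mono hST), card_smul_mcFisher δ v hS,
    ← Finset.sum_sdiff hST, sub_mul, sub_smul]
  abel

/-- The exact trace decomposition of the Fisher information ratio objective
`tr[Î(X_q)⁻¹ Î(X_p)]` in pool-based active learning. -/
theorem stmt5 {α : Type*} [DecidableEq α] {d c : ℕ} (hc : 1 ≤ c)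
    (δ : ℝ) (hδ : 0 < δ) (v : α → Fin c → (Fin d → ℝ))
    (Xp Xq : Finset α) (hsub : Xq ⊆ Xp) (hq : Xq.Nonempty) (hp : Xp.Nonempty) :
    ((mcFisher d c δ v Xq)⁻¹ * mcFisher d c δ v Xp).trace =
      (Xq.card * d : ℝ) / Xp.card +
      (1 / (Xp.card : ℝ)) * ∑ x ∈ Xp \ Xq, ∑ y : Fin c,
        v x y ⬝ᵥ (mcFisher d c δ v Xq)⁻¹.mulVec (v x y) +
      δ * (((Xp.card : ℝ) - Xq.card) / Xp.card) * ((mcFisher d c δ v Xq)⁻¹).trace := by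
  have hp0 : (Xp.card : ℝ) ≠ 0 := by exact_mod_cast hp.card_pos.ne'
  have hdet : IsUnit (mcFisher d c δ v Xq).det :=
    (Matrix.isUnit_iff_isUnit_det _).mp (mcFisher_posDef hδ v Xq).isUnit
  have key := congrArg (fun M => ((mcFisher d c δ v Xq)⁻¹ * M).trace)
    (card_smul_mcFisher_of_subset δ v hsub hq)
  simp only [Matrix.mul_add, Matrix.mul_smul, Matrix.mul_one, Matrix.nonsing_inv_mul _ hdet,
    Matrix.mul_sum, Matrix.mul_vecMulVec, Matrix.trace_add, Matrix.trace_smul, Matrix.trace_sum,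
    Matrix.trace_vecMulVec, Matrix.trace_one, Fintype.card_fin, smul_eq_mul] at key
  simp only [dotProduct_comm (v _ _)]
  field_simp
  linear_combination key
end
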